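/- arXiv:1910.13554 — 2 statements merged into one kernel-verified Lean document; each statement's English description precedes it below -/
import Mathlib

section
/- Hoare rule for while loops with invariant (h-while-inv): for predicates P, I, T, Q : S → Prop and a state transformer f : S → Set S, if P implies I pointwise, the Hoare triple {λ s, I s ∧ T s} f {I} holds, and (λ s, ¬ T s ∧ I s) implies Q pointwise, then the Hoare triple {P} (WHILE T DO f) {Q} holds, where WHILE T DO f = (⌈T⌉ ∘K f)* ∘K ⌈λ s, ¬ T s⌉. -/
/-- Kleisli composition of state transformers. -/
def kcomp {S : Type*} (f g : S → Set S) : S → Set S :=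
  fun s => ⋃ s' ∈ f s, g s'

/-- Kleisli unit. -/
def eta {S : Type*} : S → Set S := fun s => {s}

/-- Kleisli powers. -/
def kpow {S : Type*} (f : S → Set S) : ℕ → S → Set S
  | 0 => eta
  | n + 1 => kcomp f (kpow f n)

/-- Kleene star of a state transformer. -/
def kstar {S : Type*} (f : S → Set S) : S → Set S :=
  fun s => ⋃ n, kpow f n s

/-- Embedding of a predicate as a test. -/
def test {S : Type*} (P : S → Prop) : S → Set S :=
  fun s => {s' | s' = s ∧ P s}

/-- Hoare triple in the state transformer model. -/
def hoare {S : Type*} (P : S → Prop) (f : S → Set S) (Q : S → Prop) : Prop :=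
  ∀ s, P s → f s ⊆ {s' | Q s'}

/-- Morgan's specification statement. -/
def spec {S : Type*} (P Q : S → Prop) : S → Set S :=
  fun s => {s' | P s → Q s'}

/-- Assignment as a state transformer. -/
def assign {V A : Type*} [DecidableEq V] (x : V) (e : (V → A) → A) :
    (V → A) → Set (V → A) :=
  fun s => {Function.update s x (e s)}

theorem hoare_kcomp {S : Type*} {P Q R : S → Prop} {f g : S → Set S}
    (hf : hoare P f R) (hg : hoare R g Q) : hoare P (kcomp f g) Q :=
  fun s hs => Set.iUnion₂_subset fun s' hs' => hg s' (hf s hs hs')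

theorem hoare_eta {S : Type*} (P : S → Prop) : hoare P eta P :=
  fun _ hs => Set.singleton_subset_iff.2 hs

theorem hoare_test {S : Type*} (P T : S → Prop) :
    hoare P (test T) (fun s => P s ∧ T s) := by
  rintro s hP _ ⟨rfl, hT⟩
  exact ⟨hP, hT⟩

theorem hoare_kpow {S : Type*} {I : S → Prop} {f : S → Set S} (hf : hoare I f I) (n : ℕ) :
    hoare I (kpow f n) I := by
  induction n with
  | zero => exact hoare_eta I
  | succ n ih => exact hoare_kcomp hf ih

theorem hoare_kstar {S : Type*} {I : S → Prop} {f : S → Set S} (hf : hoare I f I) :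
    hoare I (kstar f) I :=
  fun s hs => Set.iUnion_subset fun n => hoare_kpow hf n s hs

/-- Hoare rule for while loops with invariant (h-while-inv). -/
theorem hoare_while_inv {S : Type*} (P I T Q : S → Prop) (f : S → Set S)
    (hPI : ∀ s, P s → I s)
    (hI : hoare (fun s => I s ∧ T s) f I)
    (hIQ : ∀ s, ¬ T s ∧ I s → Q s) :
    hoare P (kcomp (kstar (kcomp (test T) f)) (test (fun s => ¬ T s))) Q := by
  intro s hs s' hs'
  have hloop := hoare_kstar (hoare_kcomp (hoare_test I T) hI)
  obtain ⟨hinv, hexit⟩ := hoare_kcomp hloop (hoare_test I fun s => ¬ T s) s (hPI s hs) hs'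
  exact hIQ s' ⟨hexit, hinv⟩
end

section
/- Refinement laws for evolution commands (r-evl, r-evll, r-evlr): let E = EuclideanSpace ℝ (Fin n), let f : E → E be Lipschitz continuous, let T ⊆ ℝ be an open interval with 0 ∈ T, let φ : ℝ → E → E be a flow for f on T (φ 0 s = s and for every t ∈ T, τ ↦ φ τ s has derivative f (φ t s) at t), let U ⊆ T be an interval with 0 ∈ U, let G, Q : E → Prop, and write W s for the predicate ∀ t ∈ U, (∀ τ ∈ U, τ ≤ t → G (φ τ s)) → Q (φ t s), and γ for the guarded orbital of f with guard G on U. Then (i) γ ≤ [W, Q]; (ii) γ ∘K [Q,Q] ≤ [W, Q]; and (iii) [Q, W] ∘K γ ≤ [Q,Q]. -/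
/-- Solutions of the initial value problem for vector field `f` on time domain `U`
with initial state `s`. -/
def Sols {n : ℕ} (f : EuclideanSpace ℝ (Fin n) → EuclideanSpace ℝ (Fin n))
    (U : Set ℝ) (s : EuclideanSpace ℝ (Fin n)) : Set (ℝ → EuclideanSpace ℝ (Fin n)) :=
  {X | (∀ t ∈ U, HasDerivAt X (f (X t)) t) ∧ X 0 = s}

/-- The guarded orbital of `f` with guard `G` on the time domain `U`:
state transformer semantics of the evolution command `x' = f & G on U`. -/
def gorbital {n : ℕ} (f : EuclideanSpace ℝ (Fin n) → EuclideanSpace ℝ (Fin n))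
    (G : EuclideanSpace ℝ (Fin n) → Prop) (U : Set ℝ)
    (s : EuclideanSpace ℝ (Fin n)) : Set (EuclideanSpace ℝ (Fin n)) :=
  {y | ∃ X ∈ Sols f U s, ∃ t ∈ U, (∀ τ ∈ U, τ ≤ t → G (X τ)) ∧ y = X t}

/-- Two solutions of an autonomous ODE with Lipschitz right-hand side that agree at a point of an
interval agree on the whole interval. -/
theorem LipschitzWith.eqOn_of_hasDerivAt {E : Type*} [NormedAddCommGroup E] [NormedSpace ℝ E]
    {f : E → E} {K : NNReal} (hf : LipschitzWith K f) {U : Set ℝ} (hU : U.OrdConnected)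
    {X Y : ℝ → E} (hX : ∀ t ∈ U, HasDerivAt X (f (X t)) t)
    (hY : ∀ t ∈ U, HasDerivAt Y (f (Y t)) t) {t₀ : ℝ} (ht₀ : t₀ ∈ U) (h : X t₀ = Y t₀) :
    Set.EqOn X Y U := by
  intro t ht
  rcases le_total t₀ t with hle | hle
  · have hs : Set.Icc t₀ t ⊆ U := hU.out ht₀ ht
    exact ODE_solution_unique (v := fun _ => f) (fun _ => hf)
      (HasDerivAt.continuousOn fun τ hτ => hX τ (hs hτ))
      (fun τ hτ => (hX τ (hs (Set.Ico_subset_Icc_self hτ))).hasDerivWithinAt)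
      (HasDerivAt.continuousOn fun τ hτ => hY τ (hs hτ))
      (fun τ hτ => (hY τ (hs (Set.Ico_subset_Icc_self hτ))).hasDerivWithinAt)
      h (Set.right_mem_Icc.2 hle)
  · have hs : Set.Icc t t₀ ⊆ U := hU.out ht ht₀
    exact ODE_solution_unique_of_mem_Icc_left (v := fun _ => f) (s := fun _ => Set.univ)
      (fun _ _ => hf.lipschitzOnWith)
      (HasDerivAt.continuousOn fun τ hτ => hX τ (hs hτ))
      (fun τ hτ => (hX τ (hs (Set.Ioc_subset_Icc_self hτ))).hasDerivWithinAt)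
      (fun _ _ => trivial)
      (HasDerivAt.continuousOn fun τ hτ => hY τ (hs hτ))
      (fun τ hτ => (hY τ (hs (Set.Ioc_subset_Icc_self hτ))).hasDerivWithinAt)
      (fun _ _ => trivial)
      h (Set.left_mem_Icc.2 hle)

/-- Refinement laws for evolution commands (r-evl, r-evll, r-evlr). -/
theorem r_evl {n : ℕ} (f : EuclideanSpace ℝ (Fin n) → EuclideanSpace ℝ (Fin n))
    (K : NNReal) (hf : LipschitzWith K f)
    (T : Set ℝ) (hT : IsOpen T) (hTc : T.OrdConnected) (hT0 : (0 : ℝ) ∈ T)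
    (φ : ℝ → EuclideanSpace ℝ (Fin n) → EuclideanSpace ℝ (Fin n))
    (hφ0 : ∀ s, φ 0 s = s)
    (hφ : ∀ s, ∀ t ∈ T, HasDerivAt (fun τ => φ τ s) (f (φ t s)) t)
    (U : Set ℝ) (hUT : U ⊆ T) (hU0 : (0 : ℝ) ∈ U) (hUc : U.OrdConnected)
    (G Q : EuclideanSpace ℝ (Fin n) → Prop) :
    gorbital f G U
        ≤ spec (fun s => ∀ t ∈ U, (∀ τ ∈ U, τ ≤ t → G (φ τ s)) → Q (φ t s)) Q ∧
    kcomp (gorbital f G U) (spec Q Q)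
        ≤ spec (fun s => ∀ t ∈ U, (∀ τ ∈ U, τ ≤ t → G (φ τ s)) → Q (φ t s)) Q ∧
    kcomp (spec Q (fun s => ∀ t ∈ U, (∀ τ ∈ U, τ ≤ t → G (φ τ s)) → Q (φ t s)))
        (gorbital f G U)
      ≤ spec Q Q := by
  have key : ∀ s, ∀ y ∈ gorbital f G U s,
      (∀ t ∈ U, (∀ τ ∈ U, τ ≤ t → G (φ τ s)) → Q (φ t s)) → Q y := by
    rintro s y ⟨X, ⟨hX, hX0⟩, t, ht, hG, rfl⟩ hW
    have hXφ : ∀ τ ∈ U, X τ = φ τ s := fun τ hτ =>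
      hf.eqOn_of_hasDerivAt hUc hX (fun τ hτ => hφ s τ (hUT hτ)) hU0
        (by rw [hX0, hφ0]) hτ
    rw [hXφ t ht]
    exact hW t ht fun τ hτ hle => hXφ τ hτ ▸ hG τ hτ hle
  refine ⟨key, fun s y hy hW => ?_, fun s y hy hQ => ?_⟩
  · obtain ⟨s', hs', hy⟩ := Set.mem_iUnion₂.1 hy
    exact hy (key s s' hs' hW)
  · obtain ⟨s', hs', hy⟩ := Set.mem_iUnion₂.1 hy
    exact key s' y hy (hs' hQ)
end
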